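/- arXiv:2210.05908 — 4 statements merged into one kernel-verified Lean document; each statement's English description precedes it below -/
import Mathlib

section
/- Let M be a type and 𝓕 an additive commutative group equipped with a support map supp : 𝓕 → Set M. Suppose Z : 𝓕 → 𝓕 is additive, i.e. Z(F+G+H) = Z(F+G) − Z(G) + Z(G+H) whenever supp F ∩ supp H = ∅. Let Ω be an additive commutative group with its own support map supp : Ω → Set M, and let V : Ω → 𝓕 be a map which is local in the sense that, whenever supp ω₁ ∩ supp ω₂ = ∅, one has V(A+ω₁+ω₂) = V(A+ω₁) − V(A) + V(A+ω₂) and supp(V(A+ωᵢ) − V(A)) ⊆ supp ωᵢ for i = 1,2. Then for all A ∈ Ω and ω₁, ω₂ ∈ Ω with supp ω₁ ∩ supp ω₂ = ∅: Z(V(A+ω₁+ω₂)) = Z(V(A+ω₁)) − Z(V(A)) + Z(V(A+ω₂)). (Part (1) of the Proposition in Section 3, with Z = ζ_h.) -/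
/-- Part (1) of the Proposition in Section 3: additivity of `Z` and locality of `V` imply
`Z(V(A+ω₁+ω₂)) = Z(V(A+ω₁)) − Z(V(A)) + Z(V(A+ω₂))` for `ω₁, ω₂` of disjoint supports. -/
theorem stmt_2 {M : Type*} {𝓕 : Type*} [AddCommGroup 𝓕] (supp : 𝓕 → Set M)
    (Z : 𝓕 → 𝓕)
    (hZ : ∀ F G H : 𝓕, supp F ∩ supp H = ∅ →
      Z (F + G + H) = Z (F + G) - Z G + Z (G + H))
    {Ω : Type*} [AddCommGroup Ω] (suppΩ : Ω → Set M) (V : Ω → 𝓕)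
    (hV : ∀ (A : Ω) (ω₁ ω₂ : Ω), suppΩ ω₁ ∩ suppΩ ω₂ = ∅ →
      V (A + ω₁ + ω₂) = V (A + ω₁) - V A + V (A + ω₂) ∧
      supp (V (A + ω₁) - V A) ⊆ suppΩ ω₁ ∧
      supp (V (A + ω₂) - V A) ⊆ suppΩ ω₂) :
    ∀ (A : Ω) (ω₁ ω₂ : Ω), suppΩ ω₁ ∩ suppΩ ω₂ = ∅ →
      Z (V (A + ω₁ + ω₂)) = Z (V (A + ω₁)) - Z (V A) + Z (V (A + ω₂)) := by
  intro A ω₁ ω₂ h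
  obtain ⟨h1, h2, h3⟩ := hV A ω₁ ω₂ h
  have hd : supp (V (A + ω₁) - V A) ∩ supp (V (A + ω₂) - V A) = ∅ :=
    Set.subset_eq_empty (Set.inter_subset_inter h2 h3) h
  have key := hZ _ (V A) _ hd
  have e1 : V (A + ω₁) - V A + V A + (V (A + ω₂) - V A) = V (A + ω₁ + ω₂) := by
    rw [h1]; abel
  have e2 : V (A + ω₁) - V A + V A = V (A + ω₁) := by abel
  have e3 : V A + (V (A + ω₂) - V A) = V (A + ω₂) := by abel
  rw [e1, e2, e3] at key
  exact key
end

section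
/- Let M be a type and 𝓕 an additive commutative group equipped with a support map supp : 𝓕 → Set M. Let N ⊆ M and suppose Z₁ : 𝓕 → 𝓕 is localized in N (i.e. Z₁(F+G) = Z₁(F) + G whenever supp G ∩ N = ∅) and supported in N (i.e. supp(Z₁(F) − F) ⊆ N for all F). Suppose Z₂ : 𝓕 → 𝓕 is additive (i.e. Z₂(F+G+H) = Z₂(F+G) − Z₂(G) + Z₂(G+H) whenever supp F ∩ supp H = ∅). Then for all F, W ∈ 𝓕 with supp W ∩ N = ∅: Z₂(Z₁(F+W)) = Z₂(Z₁(F)) − Z₂(F) + Z₂(F+W). (Part (2) of the Proposition in Section 3: with Z₂ = ζ_h, Z₁ = ζ_g^h, F = V(A), W = V(A+ω) − V(A) this reads ζ_{gh}(V(A+ω)) = ζ_{gh}(V(A)) − ζ_h(V(A)) + ζ_h(V(A+ω)).) -/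
/-- Part (2) of the Proposition in Section 3: if `Z₁` is localized and supported in `N` and
`Z₂` is additive, then `Z₂(Z₁(F+W)) = Z₂(Z₁(F)) − Z₂(F) + Z₂(F+W)` when `supp W ∩ N = ∅`. -/
theorem stmt_4 {M : Type*} {𝓕 : Type*} [AddCommGroup 𝓕] (supp : 𝓕 → Set M)
    (N : Set M) (Z₁ Z₂ : 𝓕 → 𝓕)
    (hZ₁loc : ∀ F G : 𝓕, supp G ∩ N = ∅ → Z₁ (F + G) = Z₁ F + G)
    (hZ₁supp : ∀ F : 𝓕, supp (Z₁ F - F) ⊆ N)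
    (hZ₂ : ∀ F G H : 𝓕, supp F ∩ supp H = ∅ →
      Z₂ (F + G + H) = Z₂ (F + G) - Z₂ G + Z₂ (G + H)) :
    ∀ F W : 𝓕, supp W ∩ N = ∅ →
      Z₂ (Z₁ (F + W)) = Z₂ (Z₁ F) - Z₂ F + Z₂ (F + W) := by
  intro F W hW
  have hd : supp (Z₁ F - F) ∩ supp W = ∅ := by
    rw [Set.eq_empty_iff_forall_notMem] at hW ⊢
    rintro x ⟨h1, h2⟩
    exact hW x ⟨h2, hZ₁supp F h1⟩
  have h := hZ₂ (Z₁ F - F) F W hd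
  rw [sub_add_cancel] at h
  rw [hZ₁loc F W hW, h]
end

section
/- Let M be a type and 𝓕 an additive commutative group equipped with a support map supp : 𝓕 → Set M. Let N₁, N₂ ⊆ M with N₁ ∩ N₂ = ∅. Suppose Z : 𝓕 → 𝓕 is localized in N₁ and supported in N₁, and T : 𝓕 → 𝓕 is a bijection which is localized in N₂ and supported in N₂. Then T⁻¹ ∘ Z ∘ T = Z. (This is the first step of the proof of part (3) of the Proposition in Section 3: for g, h with disjoint supports, ζ_g^h := h_L⁻¹ ∘ ζ_g ∘ h_L equals ζ_g.) -/
/-- If `Z` is localized and supported in `N₁`, and the bijection `T` is localized and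
supported in `N₂`, with `N₁ ∩ N₂ = ∅`, then `T⁻¹ ∘ Z ∘ T = Z`. -/
theorem stmt_5 {M : Type*} {𝓕 : Type*} [AddCommGroup 𝓕] (supp : 𝓕 → Set M)
    (N₁ N₂ : Set M) (hN : N₁ ∩ N₂ = ∅)
    (Z : 𝓕 → 𝓕)
    (hZloc : ∀ F G : 𝓕, supp G ∩ N₁ = ∅ → Z (F + G) = Z F + G)
    (hZsupp : ∀ F : 𝓕, supp (Z F - F) ⊆ N₁)
    (T : 𝓕 ≃ 𝓕)
    (hTloc : ∀ F G : 𝓕, supp G ∩ N₂ = ∅ → T (F + G) = T F + G)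
    (hTsupp : ∀ F : 𝓕, supp (T F - F) ⊆ N₂) :
    ∀ F : 𝓕, T.symm (Z (T F)) = Z F := by
  intro F
  rw [Equiv.symm_apply_eq]
  have h1 : supp (T F - F) ∩ N₁ = ∅ := by
    apply Set.eq_empty_of_subset_empty
    rw [← hN]
    exact fun x hx => ⟨hx.2, hTsupp F hx.1⟩
  have h2 : supp (Z F - F) ∩ N₂ = ∅ := by
    apply Set.eq_empty_of_subset_empty
    rw [← hN]
    exact fun x hx => ⟨hZsupp F hx.1, hx.2⟩
  have e1 := hZloc F _ h1
  have e2 := hTloc F _ h2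
  rw [add_sub_cancel] at e1 e2
  rw [e1, e2]
  abel
end

section
/- Let M be a type and 𝓕 an additive commutative group equipped with a support map supp : 𝓕 → Set M. Let N₁, N₂ ⊆ M with N₁ ∩ N₂ = ∅. Suppose Z₁ : 𝓕 → 𝓕 is localized in N₁ and supported in N₁, Z₂ : 𝓕 → 𝓕 is localized in N₂ and supported in N₂, and Z : 𝓕 → 𝓕 is additive. Then for all F ∈ 𝓕: Z(Z₂(Z₁(F))) = Z(Z₁(F)) − Z(F) + Z(Z₂(F)). (This is the core of part (3) of the Proposition in Section 3: with Z = ζ_h and Zᵢ = ζ_{gᵢ}^h for g₁, g₂ of disjoint supports, the cocycle relation turns it into ζ_{g₁g₂h}(V(A)) = ζ_{g₁h}(V(A)) − ζ_h(V(A)) + ζ_{g₂h}(V(A)).) -/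
/-- Core of part (3) of the Proposition in Section 3: for `Z₁, Z₂` localized and supported in
disjoint sets and `Z` additive, `Z(Z₂(Z₁(F))) = Z(Z₁(F)) − Z(F) + Z(Z₂(F))`. -/
theorem stmt_6 {M : Type*} {𝓕 : Type*} [AddCommGroup 𝓕] (supp : 𝓕 → Set M)
    (N₁ N₂ : Set M) (hN : N₁ ∩ N₂ = ∅)
    (Z₁ Z₂ Z : 𝓕 → 𝓕)
    (hZ₁loc : ∀ F G : 𝓕, supp G ∩ N₁ = ∅ → Z₁ (F + G) = Z₁ F + G)
    (hZ₁supp : ∀ F : 𝓕, supp (Z₁ F - F) ⊆ N₁)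
    (hZ₂loc : ∀ F G : 𝓕, supp G ∩ N₂ = ∅ → Z₂ (F + G) = Z₂ F + G)
    (hZ₂supp : ∀ F : 𝓕, supp (Z₂ F - F) ⊆ N₂)
    (hZ : ∀ F G H : 𝓕, supp F ∩ supp H = ∅ →
      Z (F + G + H) = Z (F + G) - Z G + Z (G + H)) :
    ∀ F : 𝓕, Z (Z₂ (Z₁ F)) = Z (Z₁ F) - Z F + Z (Z₂ F) := by
  intro F
  have hA : supp (Z₁ F - F) ∩ N₂ = ∅ :=
    Set.subset_eq_empty (Set.inter_subset_inter_left _ (hZ₁supp F)) hN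
  have hAB : supp (Z₁ F - F) ∩ supp (Z₂ F - F) = ∅ :=
    Set.subset_eq_empty (Set.inter_subset_inter (hZ₁supp F) (hZ₂supp F)) hN
  have h1 := hZ₂loc F (Z₁ F - F) hA
  have h2 := hZ (Z₁ F - F) F (Z₂ F - F) hAB
  rw [add_sub_cancel] at h1
  rw [sub_add_cancel, add_sub_cancel] at h2
  rw [h1, ← h2]
  congr 1
  abel
end
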